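/- Let γ : [0, l] → T² be a unit-speed, simple, closed C² curve in the flat two-dimensional torus T² = R²/Z², with (signed) curvature κ. Then the total curvature ∫₀^l κ(γ(τ)) dτ belongs to the set {0, 2π, −2π}. -/

import Mathlib

/-- A continuous function on a preconnected set is constant there if its exponential is. -/
lemma Complex.eq_of_exp_const {X : Type*} [TopologicalSpace X] {S : Set X} (hS : IsPreconnected S)
    {D : X → ℂ} (hD : ContinuousOn D S) {w : ℂ} (hw : ∀ a ∈ S, Complex.exp (D a) = w)
    {a b : X} (ha : a ∈ S) (hb : b ∈ S) : D a = D b :=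
  Complex.isCoveringMap_exp.constOn_of_comp hS hD
    (fun _ h₁ _ h₂ ↦ Subtype.ext ((hw _ h₁).trans (hw _ h₂).symm)) ha hb

/-- A nowhere vanishing continuous function on the plane has a continuous logarithm. -/
lemma exists_continuous_log_of_ne_zero {F : ℝ × ℝ → ℂ} (hF : Continuous F) (h0 : ∀ p, F p ≠ 0) :
    ∃ L : ℝ × ℝ → ℂ, Continuous L ∧ ∀ p, Complex.exp (L p) = F p := by
  obtain ⟨f, ⟨-, hf⟩, -⟩ := Complex.isCoveringMapOn_exp.existsUnique_continuousMap_lifts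
    ⟨F, hF⟩ (Complex.exp_log (h0 (0, 0))) h0
  exact ⟨f, f.continuous, fun p ↦ congrFun hf p⟩

/-- A logarithm along a path in the closed upper half plane, from `ε` to `-ε` with `ε = ±1`,
changes by `ε * π * I`. -/
lemma log_change_of_im_nonneg {a b : ℝ} (hab : a ≤ b) {L : ℝ → ℂ} (hL : Continuous L)
    (him : ∀ u ∈ Set.Icc a b, 0 ≤ (Complex.exp (L u)).im) {ε : ℂ} (hε : ε = 1 ∨ ε = -1)
    (ha : Complex.exp (L a) = ε) (hb : Complex.exp (L b) = -ε) :
    L b - L a = ε * Real.pi * Complex.I := by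
  have hslit : ∀ u ∈ Set.Icc a b, -Complex.I * Complex.exp (L u) ∈ Complex.slitPlane := by
    intro u hu
    have hne := Complex.exp_ne_zero (L u)
    rw [Complex.mem_slitPlane_iff]
    have h := him u hu
    rcases h.lt_or_eq with h | h
    · left; simpa using h
    · right
      intro h'
      apply hne
      apply Complex.ext
      · simpa using h'
      · exact h.symm
  have hcont : ContinuousOn (fun u ↦ L u - Complex.log (-Complex.I * Complex.exp (L u)))
      (Set.Icc a b) := by
    refine hL.continuousOn.sub (ContinuousOn.clog ?_ hslit)
    fun_prop
  have h := Complex.eq_of_exp_const isPreconnected_Icc hcont (w := Complex.I) (fun u hu ↦ by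
    have hne := Complex.exp_ne_zero (L u)
    rw [Complex.exp_sub, Complex.exp_log (by simp)]
    field_simp
    simp) (Set.right_mem_Icc.2 hab) (Set.left_mem_Icc.2 hab)
  simp only [ha, hb] at h
  rcases hε with rfl | rfl
  · simp only [mul_neg, mul_one, neg_neg, Complex.log_I, Complex.log_neg_I] at h
    linear_combination h
  · simp only [mul_neg, mul_one, neg_neg, Complex.log_I, Complex.log_neg_I] at h
    linear_combination h

/-- The average of `V` over the interval from `p.1` to `p.1 + p.2`. -/
noncomputable def segmentAverage (V : ℝ → ℂ) (p : ℝ × ℝ) : ℂ :=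
  ∫ r in (0 : ℝ)..1, V (p.1 + r * p.2)

lemma continuous_segmentAverage {V : ℝ → ℂ} (hV : Continuous V) :
    Continuous (segmentAverage V) := by
  unfold segmentAverage
  exact intervalIntegral.continuous_parametric_intervalIntegral_of_continuous' (by fun_prop) 0 1

lemma segmentAverage_zero (V : ℝ → ℂ) (s : ℝ) : segmentAverage V (s, 0) = V s := by
  simp [segmentAverage]

lemma segmentAverage_add_period {V : ℝ → ℂ} {l : ℝ} (hper : Function.Periodic V l) (s u : ℝ) :
    segmentAverage V (s + l, u) = segmentAverage V (s, u) := by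
  unfold segmentAverage
  congr 1
  ext r
  rw [← hper (s + r * u)]
  congr 1
  ring

lemma mul_segmentAverage {V Γ : ℝ → ℂ} (hV : Continuous V) (hΓ : ∀ s, HasDerivAt Γ (V s) s)
    (s u : ℝ) : u * segmentAverage V (s, u) = Γ (s + u) - Γ s := by
  have h := intervalIntegral.integral_eq_sub_of_hasDerivAt (a := 0) (b := 1)
    (f := fun r : ℝ ↦ Γ (s + r * u)) (f' := fun r ↦ u • V (s + r * u)) (fun r _ ↦ by
      have h1 : HasDerivAt (fun r : ℝ ↦ s + r * u) u r := by
        simpa using ((hasDerivAt_id r).mul_const u).const_add s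
      exact (hΓ (s + r * u)).scomp r h1)
    (Continuous.intervalIntegrable (by fun_prop) _ _)
  rw [intervalIntegral.integral_smul] at h
  simpa [segmentAverage] using h

/-- A nowhere vanishing continuous function of `(s, u)` which is periodic in `s` has a continuous
logarithm whose increment over a period does not depend on the base point. -/
lemma exists_log_with_constant_increment {F : ℝ × ℝ → ℂ} (hF : Continuous F) (h0 : ∀ p, F p ≠ 0)
    {l : ℝ} (hper : ∀ s u, F (s + l, u) = F (s, u)) :
    ∃ L : ℝ × ℝ → ℂ, Continuous L ∧ (∀ p, Complex.exp (L p) = F p) ∧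
      ∀ s u s' u', L (s + l, u) - L (s, u) = L (s' + l, u') - L (s', u') := by
  obtain ⟨L, hL, hLF⟩ := exists_continuous_log_of_ne_zero hF h0
  refine ⟨L, hL, hLF, fun s u s' u' ↦ ?_⟩
  exact Complex.eq_of_exp_const (D := fun p : ℝ × ℝ ↦ L (p.1 + l, p.2) - L p) (w := 1)
    isPreconnected_univ (Continuous.continuousOn (by fun_prop)) (fun p _ ↦ by
      rw [Complex.exp_sub, hLF, hLF, hper, div_self (h0 _)])
    (Set.mem_univ (s, u)) (Set.mem_univ (s', u'))

/-- Rotation number of a simple curve in the plane that is invariant under a nonzero translation. -/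
lemma tangent_log_change_of_translation {l : ℝ} (hl : 0 < l) {V Γ : ℝ → ℂ} (hV : Continuous V)
    (hper : Function.Periodic V l) (hnorm : ∀ s, ‖V s‖ = 1) (hΓ : ∀ s, HasDerivAt Γ (V s) s)
    {A : ℂ} (hA : A ≠ 0) (hshift : ∀ s, Γ (s + l) = Γ s + A)
    (hinj : ∀ s u, 0 < u → u < l → Γ (s + u) ≠ Γ s) :
    ∃ L : ℝ → ℂ, Continuous L ∧ (∀ s, Complex.exp (L s) = V s) ∧ L l - L 0 = 0 := by
  have hne : ∀ s u, 0 ≤ u → u ≤ l → segmentAverage V (s, u) ≠ 0 := by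
    intro s u h0 h1 hz
    have h := mul_segmentAverage hV hΓ s u
    rw [hz, mul_zero] at h
    rcases h0.eq_or_lt with rfl | h0
    · rw [segmentAverage_zero] at hz
      simpa [hz] using hnorm s
    · rcases h1.eq_or_lt with rfl | h1
      · rw [hshift] at h
        exact hA (by linear_combination -h)
      · exact hinj s u h0 h1 (sub_eq_zero.1 h.symm)
  have hVc := continuous_segmentAverage hV
  obtain ⟨L, hL, hLF, hinc⟩ := exists_log_with_constant_increment
    (F := fun p ↦ segmentAverage V (p.1, max 0 (min p.2 l))) (l := l) (by fun_prop)
    (fun p ↦ hne _ _ (le_max_left _ _) (max_le hl.le (min_le_right _ _)))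
    (fun s u ↦ segmentAverage_add_period hper _ _)
  refine ⟨fun s ↦ L (s, 0), by fun_prop, fun s ↦ ?_, ?_⟩
  · rw [hLF]
    simp [hl.le, segmentAverage_zero]
  · have h1 := hinc 0 0 0 l
    have h2 := Complex.eq_of_exp_const (D := fun s : ℝ ↦ L (s, l)) (w := A / l)
      isPreconnected_univ (Continuous.continuousOn (by fun_prop)) (fun s _ ↦ by
        have h := mul_segmentAverage hV hΓ s l
        have hl' : (l : ℂ) ≠ 0 := by exact_mod_cast hl.ne'
        rw [hLF, eq_div_iff hl']
        simp only [min_self, max_eq_right hl.le]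
        rw [hshift] at h
        linear_combination h) (Set.mem_univ (0 + l)) (Set.mem_univ 0)
    rw [h2, sub_self, zero_add] at h1
    exact h1

/-- Hopf's Umlaufsatz: rotation number of a simple closed plane curve. -/
lemma tangent_log_change_of_closed {l : ℝ} (hl : 0 < l) {V Γ : ℝ → ℂ} (hV : Continuous V)
    (hper : Function.Periodic V l) (hnorm : ∀ s, ‖V s‖ = 1) (hΓ : ∀ s, HasDerivAt Γ (V s) s)
    (hshift : Function.Periodic Γ l) (hinj : ∀ s u, 0 < u → u < l → Γ (s + u) ≠ Γ s) :
    ∃ L : ℝ → ℂ, Continuous L ∧ (∀ s, Complex.exp (L s) = V s) ∧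
      (L l - L 0 = 2 * Real.pi * Complex.I ∨ L l - L 0 = -(2 * Real.pi * Complex.I)) := by
  have hl' : (l : ℂ) ≠ 0 := by exact_mod_cast hl.ne'
  have hVc := continuous_segmentAverage hV
  set H : ℝ × ℝ → ℂ := fun p ↦ segmentAverage V p - segmentAverage V (p.1 + p.2, l - p.2) with hH
  have hfull : ∀ s, segmentAverage V (s, l) = 0 := fun s ↦ by
    have h := mul_segmentAverage hV hΓ s l
    rw [hshift, sub_self] at h
    exact (mul_eq_zero.1 h).resolve_left hl'
  have hH0 : ∀ s, H (s, 0) = V s := fun s ↦ by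
    simp [hH, hfull, segmentAverage_zero]
  have hHl : ∀ s, H (s, l) = -V s := fun s ↦ by
    simp only [hH, hfull, sub_self, segmentAverage_zero, zero_sub, hper s]
  have hHmul : ∀ s u : ℝ, ((u * (l - u) : ℝ) : ℂ) * H (s, u) = (l : ℂ) * (Γ (s + u) - Γ s) := by
    intro s u
    have h1 := mul_segmentAverage hV hΓ s u
    have h2 := mul_segmentAverage hV hΓ (s + u) (l - u)
    rw [show s + u + (l - u) = s + l by ring, hshift] at h2
    push_cast at h2 ⊢
    simp only [hH]
    linear_combination (l - u : ℂ) * h1 - u * h2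
  have hne : ∀ s u, 0 ≤ u → u ≤ l → H (s, u) ≠ 0 := by
    intro s u h0 h1 hz
    rcases h0.eq_or_lt with rfl | h0
    · rw [hH0] at hz
      simpa [hz] using hnorm s
    · rcases h1.eq_or_lt with rfl | h1
      · rw [hHl, neg_eq_zero] at hz
        simpa [hz] using hnorm s
      · have h := hHmul s u
        rw [hz, mul_zero] at h
        exact hinj s u h0 h1 (sub_eq_zero.1 ((mul_eq_zero.1 h.symm).resolve_left hl'))
  have hHim : ∀ s u : ℝ, u * (l - u) * (H (s, u)).im = l * ((Γ (s + u)).im - (Γ s).im) := by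
    intro s u
    simpa only [Complex.im_ofReal_mul, Complex.sub_im] using congrArg Complex.im (hHmul s u)
  obtain ⟨L, hL, hLF, hinc⟩ := exists_log_with_constant_increment
    (F := fun p ↦ H (p.1, max 0 (min p.2 l))) (l := l) (by fun_prop)
    (fun p ↦ hne _ _ (le_max_left _ _) (max_le hl.le (min_le_right _ _)))
    (fun s u ↦ by
      simp only [hH, segmentAverage_add_period hper]
      rw [add_right_comm, segmentAverage_add_period hper])
  have hLH : ∀ s, ∀ u ∈ Set.Icc 0 l, Complex.exp (L (s, u)) = H (s, u) := fun s u hu ↦ by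
    rw [hLF]
    simp only [min_eq_left hu.2, max_eq_right hu.1]
  have hl0 : (0 : ℝ) ∈ Set.Icc 0 l := ⟨le_rfl, hl.le⟩
  have hll : l ∈ Set.Icc 0 l := ⟨hl.le, le_rfl⟩
  have hΓc : Continuous Γ := continuous_iff_continuousAt.2 fun s ↦ (hΓ s).continuousAt
  obtain ⟨s₀, -, hs₀⟩ := isCompact_Icc.exists_isMinOn (Set.nonempty_Icc.2 hl.le)
    (Complex.continuous_im.comp hΓc).continuousOn
  have hmin : ∀ s, (Γ s₀).im ≤ (Γ s).im := fun s ↦ by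
    obtain ⟨t, ht, hst⟩ := hshift.exists_mem_Ico₀ hl s
    rw [hst]
    exact hs₀ ⟨ht.1, ht.2.le⟩
  have hVim : (V s₀).im = 0 := by
    refine IsLocalMin.hasDerivAt_eq_zero (f := fun s ↦ (Γ s).im) (Filter.Eventually.of_forall hmin)
      ?_
    exact Complex.imCLM.hasFDerivAt.comp_hasDerivAt s₀ (hΓ s₀)
  obtain ⟨ε, hε, hVε⟩ : ∃ ε : ℂ, (ε = 1 ∨ ε = -1) ∧ V s₀ = ε := by
    refine ⟨V s₀, ?_, rfl⟩
    have hre : ((V s₀).re : ℂ) = V s₀ := Complex.ext (by simp) (by simp [hVim])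
    have h := hnorm s₀
    rw [← hre, Complex.norm_real, Real.norm_eq_abs, abs_eq zero_le_one] at h
    rw [← hre]
    rcases h with h | h <;> simp [h]
  have hVl : V (s₀ + l) = ε := by rw [hper, hVε]
  have key1 : L (s₀, l) - L (s₀, 0) = ε * Real.pi * Complex.I := by
    refine log_change_of_im_nonneg hl.le (L := fun u ↦ L (s₀, u)) (by fun_prop) ?_ hε
      (by rw [hLH _ _ hl0, hH0, hVε]) (by rw [hLH _ _ hll, hHl, hVε])
    intro u hu
    rw [hLH _ _ hu]
    rcases hu.1.eq_or_lt with rfl | h0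
    · rw [hH0, hVim]
    · rcases hu.2.eq_or_lt with rfl | h1
      · simp [hHl, hVim]
      · refine nonneg_of_mul_nonneg_right ?_ (mul_pos h0 (sub_pos.2 h1))
        rw [hHim]
        exact mul_nonneg hl.le (sub_nonneg.2 (hmin _))
  have key2 : L (s₀ + l, 0) - L (s₀, l) = ε * Real.pi * Complex.I := by
    have h := log_change_of_im_nonneg hl.le
      (L := fun u ↦ L (s₀ + u, l - u) + Real.pi * Complex.I) (ε := ε) (by fun_prop) ?_ hε
      (by simp [Complex.exp_add, hLH _ _ hll, hHl, hVε])
      (by simp [Complex.exp_add, hLH _ _ hl0, hH0, hVl])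
    · simpa using h
    intro u hu
    have hu' : l - u ∈ Set.Icc 0 l := ⟨sub_nonneg.2 hu.2, sub_le_self _ hu.1⟩
    rw [Complex.exp_add, Complex.exp_pi_mul_I, hLH _ _ hu', mul_neg_one, Complex.neg_im,
      neg_nonneg]
    rcases hu.1.eq_or_lt with rfl | h0
    · simp [hHl, hVim]
    · rcases hu.2.eq_or_lt with rfl | h1
      · simp [hH0, hper s₀, hVim]
      · have h := hHim (s₀ + u) (l - u)
        rw [show s₀ + u + (l - u) = s₀ + l by ring, hshift, sub_sub_cancel] at h
        have h2 := mul_nonneg hl.le (sub_nonneg.2 (hmin (s₀ + u)))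
        have h3 := mul_pos (sub_pos.2 h1) h0
        by_contra! hc
        nlinarith [mul_pos h3 hc]
  refine ⟨fun s ↦ L (s, 0), by fun_prop, fun s ↦ by rw [hLH _ _ hl0, hH0], ?_⟩
  have h := hinc 0 0 s₀ 0
  rw [zero_add] at h
  rcases hε with rfl | rfl
  · left; linear_combination h + key1 + key2
  · right; linear_combination h + key1 + key2

/-- The total curvature of a curve is the increment of any continuous logarithm of its tangent. -/
lemma integral_curvature_eq_log_change {l : ℝ} (hl : 0 ≤ l) {x y : ℝ → ℝ}
    (hx : ContDiff ℝ 2 x) (hy : ContDiff ℝ 2 y)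
    (hunit : ∀ s : ℝ, (deriv x s) ^ 2 + (deriv y s) ^ 2 = 1)
    {L : ℝ → ℂ} (hL : Continuous L)
    (hLV : ∀ s ∈ Set.Icc 0 l, Complex.exp (L s) = deriv x s + deriv y s * Complex.I) :
    ((∫ s in (0:ℝ)..l, (deriv x s * deriv (deriv y) s - deriv y s * deriv (deriv x) s) : ℝ) : ℂ)
      * Complex.I = L l - L 0 := by
  have hx1 : ContDiff ℝ 1 (deriv x) := (contDiff_succ_iff_deriv (n := 1).1 hx).2.2
  have hy1 : ContDiff ℝ 1 (deriv y) := (contDiff_succ_iff_deriv (n := 1).1 hy).2.2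
  have hdx : ∀ s, HasDerivAt (deriv x) (deriv (deriv x) s) s :=
    fun s ↦ (hx1.differentiable one_ne_zero s).hasDerivAt
  have hdy : ∀ s, HasDerivAt (deriv y) (deriv (deriv y) s) s :=
    fun s ↦ (hy1.differentiable one_ne_zero s).hasDerivAt
  have hcx := hx1.continuous_deriv le_rfl
  have hcy := hy1.continuous_deriv le_rfl
  have hcx' := hx1.continuous
  have hcy' := hy1.continuous
  set κ : ℝ → ℝ := fun s ↦ deriv x s * deriv (deriv y) s - deriv y s * deriv (deriv x) s with hκ
  have hκc : Continuous κ := by fun_prop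
  have hΦ : ∀ s, HasDerivAt (fun s ↦ ∫ t in (0:ℝ)..s, κ t) (κ s) s :=
    fun s ↦ intervalIntegral.integral_hasDerivAt_right (hκc.intervalIntegrable _ _)
      (hκc.stronglyMeasurableAtFilter _ _) hκc.continuousAt
  set Φ : ℝ → ℝ := fun s ↦ ∫ t in (0:ℝ)..s, κ t with hΦdef
  have horth : ∀ s, deriv x s * deriv (deriv x) s + deriv y s * deriv (deriv y) s = 0 := by
    intro s
    have h := ((hdx s).pow 2).add ((hdy s).pow 2)
    have h' : (deriv x ^ 2 + deriv y ^ 2 : ℝ → ℝ) = fun _ ↦ 1 := funext hunit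
    rw [h'] at h
    have := h.unique (hasDerivAt_const s 1)
    simp at this
    linarith
  have hconst : ∀ s t : ℝ, (((deriv x s : ℝ) : ℂ) + deriv y s * Complex.I) * Complex.exp (-(Φ s * Complex.I)) =
      (deriv x t + deriv y t * Complex.I) * Complex.exp (-(Φ t * Complex.I)) := by
    have hd : ∀ s, HasDerivAt
        (fun s ↦ (((deriv x s : ℝ) : ℂ) + (deriv y s : ℝ) * Complex.I) *
          Complex.exp (-((Φ s : ℝ) * Complex.I))) 0 s := by
      intro s
      have h := ((hdx s).ofReal_comp.add ((hdy s).ofReal_comp.mul_const Complex.I)).mul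
        (((hΦ s).ofReal_comp.mul_const Complex.I).neg.cexp)
      refine h.congr_deriv ?_
      have e1 : ((deriv x s : ℝ) : ℂ) ^ 2 + ((deriv y s : ℝ) : ℂ) ^ 2 = 1 := by exact_mod_cast hunit s
      have e2 : ((deriv x s : ℝ) : ℂ) * deriv (deriv x) s + deriv y s * deriv (deriv y) s = 0 := by
        exact_mod_cast horth s
      simp only [hκ, Pi.add_apply]
      push_cast
      generalize Complex.exp _ = E
      linear_combination E * (-(((deriv (deriv x) s : ℝ) : ℂ) + (deriv (deriv y) s : ℝ) * Complex.I) * e1 +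
        (((deriv x s : ℝ) : ℂ) + (deriv y s : ℝ) * Complex.I) * e2 -
        ((deriv y s : ℝ) : ℂ) * ((deriv x s : ℝ) * (deriv (deriv y) s : ℝ) -
          (deriv y s : ℝ) * (deriv (deriv x) s : ℝ)) * Complex.I_sq)
    exact is_const_of_deriv_eq_zero (fun s ↦ (hd s).differentiableAt) fun s ↦ (hd s).deriv
  have hΦc : Continuous Φ := continuous_iff_continuousAt.2 fun s ↦ (hΦ s).continuousAt
  have h := Complex.eq_of_exp_const (D := fun s : ℝ ↦ L s - Φ s * Complex.I)
    (w := (deriv x 0 + deriv y 0 * Complex.I) * Complex.exp (-(Φ 0 * Complex.I)))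
    isPreconnected_Icc (Continuous.continuousOn (by fun_prop)) (fun s hs ↦ by
      rw [sub_eq_add_neg, Complex.exp_add, hLV s hs, hconst s 0])
    (Set.right_mem_Icc.2 hl) (Set.left_mem_Icc.2 hl)
  have hΦ0 : Φ 0 = 0 := by simp [hΦdef]
  simp only [hΦ0] at h
  push_cast at h
  linear_combination -h

/-- A curve that closes up modulo a translation, together with its tangent, on `[0, l]` extends
to a curve on the whole line commuting with that translation. -/
lemma exists_quasiperiodic_extension {l : ℝ} (hl : 0 < l) {c W : ℝ → ℂ} (hW : Continuous W)
    (hc : ∀ s, HasDerivAt c (W s) s) (hWl : W 0 = W l) :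
    ∃ V Γ : ℝ → ℂ, Continuous V ∧ Function.Periodic V l ∧ (∀ s, HasDerivAt Γ (V s) s) ∧
      (∀ s ∈ Set.Icc 0 l, V s = W s) ∧ (∀ s ∈ Set.Icc 0 l, Γ s = c s) ∧
      ∀ s, Γ (s + l) = Γ s + (c l - c 0) := by
  have : Fact (0 < l) := ⟨hl⟩
  set V : ℝ → ℂ := fun s ↦ AddCircle.liftIco l 0 W (s : AddCircle l) with hVdef
  have hV : Continuous V := (AddCircle.liftIco_zero_continuous hWl hW.continuousOn).comp
    (AddCircle.continuous_mk' l)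
  have hper : Function.Periodic V l := fun s ↦ by simp [hVdef]
  have hVW : ∀ s ∈ Set.Icc 0 l, V s = W s := fun s hs ↦ by
    rcases hs.2.eq_or_lt with rfl | h
    · rw [← hWl, ← zero_add s, hper 0]
      exact AddCircle.liftIco_zero_coe_apply ⟨le_rfl, hl⟩
    · exact AddCircle.liftIco_zero_coe_apply ⟨hs.1, h⟩
  have hI : ∀ s ∈ Set.Icc 0 l, ∫ t in (0:ℝ)..s, V t = c s - c 0 := fun s hs ↦ by
    rw [← intervalIntegral.integral_eq_sub_of_hasDerivAt (fun t _ ↦ hc t)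
      (hW.intervalIntegrable _ _)]
    refine intervalIntegral.integral_congr fun t ht ↦ hVW t ?_
    rw [Set.uIcc_of_le hs.1] at ht
    exact ⟨ht.1, ht.2.trans hs.2⟩
  refine ⟨V, fun s ↦ c 0 + ∫ t in (0:ℝ)..s, V t, hV, hper, fun s ↦ ?_, hVW, fun s hs ↦ ?_,
    fun s ↦ ?_⟩
  · exact (intervalIntegral.integral_hasDerivAt_right (hV.intervalIntegrable _ _)
      (hV.stronglyMeasurableAtFilter _ _) hV.continuousAt).const_add _
  · simp only [hI s hs]
    ring
  · simp only
    rw [← intervalIntegral.integral_add_adjacent_intervals (b := s)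
      (hV.intervalIntegrable _ _) (hV.intervalIntegrable _ _),
      hper.intervalIntegral_add_eq s 0, zero_add, hI l ⟨hl.le, le_rfl⟩]
    ring

theorem total_curvature_of_simple_closed_torus_curve
    (l : ℝ) (hl : 0 < l) (x y : ℝ → ℝ)
    (hx : ContDiff ℝ 2 x) (hy : ContDiff ℝ 2 y)
    (hunit : ∀ s : ℝ, (deriv x s) ^ 2 + (deriv y s) ^ 2 = 1)
    (hclosedx : ∃ n : ℤ, x l = x 0 + n)
    (hclosedy : ∃ n : ℤ, y l = y 0 + n)
    (hperx : deriv x l = deriv x 0) (hpery : deriv y l = deriv y 0)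
    (hsimple : ∀ s ∈ Set.Ico (0:ℝ) l, ∀ t ∈ Set.Ico (0:ℝ) l,
      (∃ m n : ℤ, x s = x t + m ∧ y s = y t + n) → s = t) :
    (∫ s in (0:ℝ)..l, (deriv x s * deriv (deriv y) s - deriv y s * deriv (deriv x) s))
      ∈ ({0, 2 * Real.pi, -(2 * Real.pi)} : Set ℝ) := by
  obtain ⟨m, hm⟩ := hclosedx
  obtain ⟨n, hn⟩ := hclosedy
  have hcx := hx.continuous_deriv one_le_two
  have hcy := hy.continuous_deriv one_le_two
  obtain ⟨V, Γ, hV, hper, hΓ, hVW, hΓc, hshift⟩ := exists_quasiperiodic_extension hl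
    (c := fun s ↦ x s + y s * Complex.I) (W := fun s ↦ deriv x s + deriv y s * Complex.I)
    (by fun_prop)
    (fun s ↦ ((hx.differentiable two_ne_zero s).hasDerivAt.ofReal_comp).add
      (((hy.differentiable two_ne_zero s).hasDerivAt.ofReal_comp).mul_const Complex.I))
    (by simp [hperx, hpery])
  have hnorm : ∀ s, ‖V s‖ = 1 := fun s ↦ by
    obtain ⟨t, ht, hst⟩ := hper.exists_mem_Ico₀ hl s
    rw [hst, hVW t ⟨ht.1, ht.2.le⟩, Complex.norm_add_mul_I, hunit, Real.sqrt_one]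
  set A : ℂ := (x l + y l * Complex.I) - (x 0 + y 0 * Complex.I) with hA
  have hAmn : A = m + n * Complex.I := by
    rw [hA, hm, hn]; push_cast; ring
  have hzshift : ∀ (k : ℤ) s, Γ (s + k * l) = Γ s + k * A := by
    intro k s
    have hp : Function.Periodic (fun s : ℝ ↦ Γ s - s / l * A) l := fun s ↦ by
      have : (l : ℂ) ≠ 0 := by exact_mod_cast hl.ne'
      simp only [hshift]
      push_cast
      field_simp
      ring
    have h := hp.int_mul k s
    have : (l : ℂ) ≠ 0 := by exact_mod_cast hl.ne'
    push_cast at h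
    field_simp at h
    apply mul_right_cancel₀ this
    linear_combination h
  have hinj : ∀ s u, 0 < u → u < l → Γ (s + u) ≠ Γ s := by
    intro s u hu0 hul heq
    have hred : ∀ r, ∃ k : ℤ, ∃ t ∈ Set.Ico 0 l, r = t + k * l := fun r ↦ by
      refine ⟨toIcoDiv hl 0 r, toIcoMod hl 0 r, by simpa using toIcoMod_mem_Ico hl 0 r, ?_⟩
      have := toIcoMod_add_toIcoDiv_zsmul hl 0 r
      rw [zsmul_eq_mul] at this
      exact this.symm
    obtain ⟨j, a, ha, hja⟩ := hred (s + u)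
    obtain ⟨k, b, hb, hkb⟩ := hred s
    rw [hja, hkb, hzshift, hzshift, hΓc a ⟨ha.1, ha.2.le⟩, hΓc b ⟨hb.1, hb.2.le⟩, hAmn] at heq
    have hre := congrArg Complex.re heq
    have him := congrArg Complex.im heq
    simp at hre him
    have hab := hsimple a ha b hb ⟨(k - j) * m, (k - j) * n, by push_cast; linarith,
      by push_cast; linarith⟩
    have hu : u = ((j - k : ℤ) : ℝ) * l := by push_cast; linarith
    rw [hu] at hu0 hul
    have h1 : (0 : ℤ) < j - k := by
      have := pos_of_mul_pos_left hu0 hl.le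
      exact_mod_cast this
    have h2 : j - k < (1 : ℤ) := by
      have : ((j - k : ℤ) : ℝ) < 1 := by
        by_contra! hc
        nlinarith
      exact_mod_cast this
    omega
  have finish : ∀ {L : ℝ → ℂ}, Continuous L → (∀ s, Complex.exp (L s) = V s) → ∀ {r : ℝ},
      L l - L 0 = r * Complex.I →
      (∫ s in (0:ℝ)..l, (deriv x s * deriv (deriv y) s - deriv y s * deriv (deriv x) s)) = r := by
    intro L hL hLV r hr
    have h := integral_curvature_eq_log_change hl.le hx hy hunit hL
      (fun s hs ↦ (hLV s).trans (hVW s hs))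
    rw [hr] at h
    exact_mod_cast mul_right_cancel₀ Complex.I_ne_zero h
  by_cases hA0 : A = 0
  · obtain ⟨L, hL, hLV, h⟩ := tangent_log_change_of_closed hl hV hper hnorm hΓ
      (fun s ↦ by rw [hshift, hA0, add_zero]) hinj
    rcases h with h | h
    · exact Or.inr (Or.inl (finish hL hLV (by rw [h]; push_cast; ring)))
    · exact Or.inr (Or.inr (finish hL hLV (by rw [h]; push_cast; ring)))
  · obtain ⟨L, hL, hLV, h⟩ := tangent_log_change_of_translation hl hV hper hnorm hΓ hA0 hshift hinj
    exact Or.inl (finish hL hLV (by rw [h]; simp))
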